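/- arXiv:2112.02660 — 2 statements merged into one kernel-verified Lean document; each statement's English description precedes it below -/
import Mathlib

section
/- Let Y be a Poisson random variable with rate γ > 0, let μ > 0 and q ≥ 0 be real numbers, and set s := ⌊γq/μ⌋. Then the expected shortage of the scaled Poisson demand D := (μ/γ)·Y at base-stock level q satisfies E[(D − q)⁺] = (μ − q)·(1 − F_γ(s)) + μ·P_γ(s), where P_γ(k) = e^{−γ}γ^k/k! is the Poisson PMF and F_γ(s) = Σ_{k=0}^s P_γ(k) is the Poisson CDF. -/
open MeasureTheory

/-- The Poisson PMF `P_γ(k) = e^{−γ} γ^k / k!`. -/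
noncomputable def poissonPMF (γ : ℝ) (k : ℕ) : ℝ :=
  Real.exp (-γ) * γ ^ k / (Nat.factorial k)

/-- The Poisson CDF `F_γ(s) = Σ_{k=0}^s P_γ(k)`. -/
noncomputable def poissonCDF (γ : ℝ) (s : ℕ) : ℝ :=
  ∑ k ∈ Finset.range (s + 1), poissonPMF γ k

theorem hasSum_poissonPMF {γ : ℝ} (hγ : 0 ≤ γ) : HasSum (poissonPMF γ) 1 :=
  ProbabilityTheory.hasSum_one_poissonMeasure ⟨γ, hγ⟩

theorem succ_mul_poissonPMF_succ (γ : ℝ) (k : ℕ) :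
    ((k : ℝ) + 1) * poissonPMF γ (k + 1) = γ * poissonPMF γ k := by
  unfold poissonPMF
  rw [Nat.factorial_succ]
  push_cast
  field_simp
  ring

theorem map_eq_poissonMeasure {Ω : Type*} [MeasurableSpace Ω] {P : Measure Ω} {Y : Ω → ℕ}
    (hYmeas : Measurable Y) {r : NNReal}
    (hY : ∀ k : ℕ, P {ω | Y ω = k} = ENNReal.ofReal (poissonPMF r k)) :
    P.map Y = ProbabilityTheory.poissonMeasure r := by
  refine Measure.ext_of_singleton fun k => ?_
  rw [Measure.map_apply hYmeas (measurableSet_singleton k),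
    ProbabilityTheory.poissonMeasure_singleton]
  exact hY k

theorem hasSum_poissonPMF_mul_shortage {γ μ q : ℝ} (hγ : 0 < γ) (hμ : 0 < μ) (hq : 0 ≤ q) :
    HasSum (fun k : ℕ => poissonPMF γ k * max (μ / γ * k - q) 0)
      ((μ - q) * (1 - poissonCDF γ ⌊γ * q / μ⌋₊) + μ * poissonPMF γ ⌊γ * q / μ⌋₊) := by
  set s := ⌊γ * q / μ⌋₊ with hs
  have hle (k : ℕ) : μ / γ * k ≤ q ↔ k ≤ s := by
    rw [hs, Nat.le_floor_iff (by positivity), le_div_iff₀ hμ, div_mul_eq_mul_div,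
      div_le_iff₀ hγ, mul_comm μ, mul_comm q]
  have hzero : ∑ k ∈ Finset.range (s + 1), poissonPMF γ k * max (μ / γ * k - q) 0 = 0 := by
    refine Finset.sum_eq_zero fun k hk => ?_
    have := (hle k).2 (Nat.lt_succ_iff.1 (Finset.mem_range.1 hk))
    rw [max_eq_right (by linarith), mul_zero]
  rw [← hasSum_nat_add_iff' (s + 1), hzero, sub_zero]
  have hp := hasSum_poissonPMF hγ.le
  have htail := (((hasSum_nat_add_iff' s).2 hp).mul_left μ).sub
    (((hasSum_nat_add_iff' (s + 1)).2 hp).mul_left q)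
  convert! htail using 1
  · funext n
    have hlt : q < μ / γ * (n + (s + 1) : ℕ) := by
      rw [← not_le, hle]
      omega
    have hrec := succ_mul_poissonPMF_succ γ (n + s)
    rw [max_eq_left (by linarith), ← add_assoc]
    push_cast at hrec ⊢
    field_simp
    linear_combination μ * hrec
  · rw [poissonCDF, Finset.sum_range_succ]
    ring

/-- **Expected shortage (Proposition 2).** For a scaled Poisson demand `D = (μ/γ)·Y` with
`Y ~ Poisson(γ)` and base-stock level `q ≥ 0`, with `s = ⌊γq/μ⌋`,
`E[(D − q)⁺] = (μ − q)(1 − F_γ(s)) + μ·P_γ(s)`. -/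
theorem expected_shortage_scaled_poisson
    {Ω : Type*} [MeasurableSpace Ω] (μm : Measure Ω) [IsProbabilityMeasure μm]
    (Y : Ω → ℕ) (hYmeas : Measurable Y) (γ μ q : ℝ) (hγ : 0 < γ) (hμ : 0 < μ) (hq : 0 ≤ q)
    (hY : ∀ k : ℕ, μm {ω | Y ω = k} = ENNReal.ofReal (poissonPMF γ k))
    (s : ℕ) (hs : s = ⌊γ * q / μ⌋₊) :
    ∫ ω, max ((μ / γ) * (Y ω : ℝ) - q) 0 ∂μm
      = (μ - q) * (1 - poissonCDF γ s) + μ * poissonPMF γ s := by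
  subst hs
  lift γ to NNReal using hγ.le
  rw [← (hasSum_poissonPMF_mul_shortage hγ hμ hq).tsum_eq,
    ← integral_map (f := fun k : ℕ => max (μ / γ * (k : ℝ) - q) 0) hYmeas.aemeasurable
      (measurable_of_countable _).aestronglyMeasurable,
    map_eq_poissonMeasure hYmeas hY, ProbabilityTheory.integral_poissonMeasure]
  rfl
end

section
/- Define g : ℝ → ℝ by g(α) := 2(1 + α²)·Φ(−α) − 2α·φ(α), where Φ and φ denote the standard normal CDF and PDF. Then g(0) = 1, g is strictly decreasing on ℝ (its derivative is g'(α) = 4(α·Φ(−α) − φ(α)) < 0 for all α), and g(α) → 0 as α → ∞. -/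
open MeasureTheory Filter

/-- The standard normal PDF `φ(t) = (1/√(2π)) e^{−t²/2}`. -/
noncomputable def stdNormalPDF (t : ℝ) : ℝ :=
  (Real.sqrt (2 * Real.pi))⁻¹ * Real.exp (-(t ^ 2) / 2)

/-- The standard normal CDF `Φ(x) = ∫_{−∞}^x φ(t) dt`. -/
noncomputable def stdNormalCDF (x : ℝ) : ℝ :=
  ∫ t in Set.Iic x, stdNormalPDF t

lemma stdNormalPDF_pos (t : ℝ) : 0 < stdNormalPDF t := by
  unfold stdNormalPDF; positivity

lemma stdNormalPDF_neg (t : ℝ) : stdNormalPDF (-t) = stdNormalPDF t := by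
  simp [stdNormalPDF]

lemma hasDerivAt_stdNormalPDF (t : ℝ) : HasDerivAt stdNormalPDF (-t * stdNormalPDF t) t := by
  have h := ((((hasDerivAt_id t).pow 2).neg.div_const 2).exp).const_mul
    (Real.sqrt (2 * Real.pi))⁻¹
  refine h.congr_deriv ?_
  simp [stdNormalPDF]
  ring

lemma continuous_stdNormalPDF : Continuous stdNormalPDF := by
  unfold stdNormalPDF; fun_prop

lemma integrable_stdNormalPDF : Integrable stdNormalPDF := by
  have h := (integrable_exp_neg_mul_sq (b := 1 / 2) (by norm_num)).const_mul
    (Real.sqrt (2 * Real.pi))⁻¹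
  refine h.congr (ae_of_all _ fun t => ?_)
  simp only [stdNormalPDF]
  ring_nf

lemma integrable_neg_mul_stdNormalPDF : Integrable fun t => -t * stdNormalPDF t := by
  have h := (integrable_mul_exp_neg_mul_sq (b := 1 / 2) (by norm_num)).const_mul
    (-(Real.sqrt (2 * Real.pi))⁻¹)
  refine h.congr (ae_of_all _ fun t => ?_)
  simp only [stdNormalPDF]
  ring_nf

lemma stdNormalCDF_nonneg (x : ℝ) : 0 ≤ stdNormalCDF x :=
  integral_nonneg fun t => (stdNormalPDF_pos t).le

lemma stdNormalCDF_zero : stdNormalCDF 0 = 1 / 2 := by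
  have h := integral_comp_neg_Ioi 0 stdNormalPDF
  rw [neg_zero] at h
  have h2 := integral_gaussian_Ioi (1 / 2)
  have h3 : Real.pi / (1 / 2) = 2 * Real.pi := by ring
  rw [h3] at h2
  have h4 : ∀ t, stdNormalPDF t =
      (Real.sqrt (2 * Real.pi))⁻¹ * Real.exp (-(1 / 2) * t ^ 2) := fun t => by
    simp only [stdNormalPDF]; ring_nf
  have h5 : Real.sqrt (2 * Real.pi) ≠ 0 := by positivity
  simp only [stdNormalPDF_neg] at h
  rw [stdNormalCDF, ← h]
  simp only [h4]
  rw [integral_const_mul, h2]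
  field_simp

lemma hasDerivAt_stdNormalCDF (x : ℝ) : HasDerivAt stdNormalCDF (stdNormalPDF x) x := by
  have h : stdNormalCDF = fun y => stdNormalCDF 0 + ∫ t in (0 : ℝ)..y, stdNormalPDF t := by
    ext y
    rw [← intervalIntegral.integral_Iic_sub_Iic integrable_stdNormalPDF.integrableOn
      integrable_stdNormalPDF.integrableOn]
    simp only [stdNormalCDF]
    ring
  rw [h]
  exact (continuous_stdNormalPDF.integral_hasStrictDerivAt 0 x).hasDerivAt.const_add _

lemma stdNormalPDF_le_exp_neg {t : ℝ} (ht : 2 ≤ t) : stdNormalPDF t ≤ Real.exp (-t) := by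
  have h1 : (Real.sqrt (2 * Real.pi))⁻¹ ≤ 1 := by
    apply inv_le_one_of_one_le₀
    rw [Real.one_le_sqrt]
    linarith [Real.pi_gt_three]
  calc stdNormalPDF t ≤ 1 * Real.exp (-(t ^ 2) / 2) := by unfold stdNormalPDF; gcongr
    _ ≤ Real.exp (-t) := by rw [one_mul, Real.exp_le_exp]; nlinarith

lemma tendsto_mul_stdNormalPDF_atTop :
    Tendsto (fun t => t * stdNormalPDF t) atTop (nhds 0) := by
  have h := Real.tendsto_pow_mul_exp_neg_atTop_nhds_zero 1
  refine squeeze_zero' ?_ ?_ h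
  · filter_upwards [eventually_ge_atTop 0] with t ht
    exact mul_nonneg ht (stdNormalPDF_pos t).le
  · filter_upwards [eventually_ge_atTop 2] with t ht
    rw [pow_one]
    exact mul_le_mul_of_nonneg_left (stdNormalPDF_le_exp_neg ht) (by linarith)

lemma tendsto_stdNormalPDF_atTop : Tendsto stdNormalPDF atTop (nhds 0) := by
  refine squeeze_zero' (Eventually.of_forall fun t => (stdNormalPDF_pos t).le) ?_
    tendsto_mul_stdNormalPDF_atTop
  filter_upwards [eventually_ge_atTop 1] with t ht
  exact le_mul_of_one_le_left (stdNormalPDF_pos t).le ht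

lemma integral_Iic_neg_mul_stdNormalPDF (x : ℝ) :
    ∫ t in Set.Iic x, -t * stdNormalPDF t = stdNormalPDF x := by
  have hbot : Tendsto stdNormalPDF atBot (nhds 0) :=
    (tendsto_stdNormalPDF_atTop.comp tendsto_neg_atBot_atTop).congr stdNormalPDF_neg
  rw [integral_Iic_of_hasDerivAt_of_tendsto' (fun t _ => hasDerivAt_stdNormalPDF t)
    integrable_neg_mul_stdNormalPDF.integrableOn hbot, sub_zero]

/-- The Mills ratio inequality. -/
lemma mul_stdNormalCDF_neg_lt (a : ℝ) : a * stdNormalCDF (-a) < stdNormalPDF a := by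
  have hint : IntegrableOn (fun t => -t * stdNormalPDF t - a * stdNormalPDF t) (Set.Iic (-a)) :=
    (integrable_neg_mul_stdNormalPDF.sub (integrable_stdNormalPDF.const_mul a)).integrableOn
  have heq : ∫ t in Set.Iic (-a), (-t * stdNormalPDF t - a * stdNormalPDF t) =
      stdNormalPDF a - a * stdNormalCDF (-a) := by
    rw [integral_sub integrable_neg_mul_stdNormalPDF.integrableOn
      (integrable_stdNormalPDF.const_mul a).integrableOn, integral_Iic_neg_mul_stdNormalPDF,
      integral_const_mul, stdNormalPDF_neg, stdNormalCDF]
  rw [← sub_pos, ← heq, setIntegral_pos_iff_support_of_nonneg_ae _ hint]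
  · refine lt_of_lt_of_le ?_ (measure_mono (s := Set.Iio (-a)) fun t ht => ⟨?_, ?_⟩)
    · simp
    · rw [Function.mem_support, ← sub_mul]
      exact mul_ne_zero (by linarith [Set.mem_Iio.1 ht]) (stdNormalPDF_pos t).ne'
    · exact Set.Iio_subset_Iic_self ht
  · filter_upwards [ae_restrict_mem measurableSet_Iic] with t ht
    rw [Pi.zero_apply, ← sub_mul]
    exact mul_nonneg (by linarith [Set.mem_Iic.1 ht]) (stdNormalPDF_pos t).le

/-- **Properties of the relative-variance function (Corollary 2).** The function
`g(α) = 2(1 + α²)Φ(−α) − 2αφ(α)` satisfies `g(0) = 1`, is strictly decreasing with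
derivative `g'(α) = 4(α·Φ(−α) − φ(α)) < 0`, and tends to `0` as `α → ∞`. -/
theorem relative_variance_function_properties (g : ℝ → ℝ)
    (hg : ∀ α, g α = 2 * (1 + α ^ 2) * stdNormalCDF (-α) - 2 * α * stdNormalPDF α) :
    g 0 = 1 ∧
      StrictAnti g ∧
      (∀ α, HasDerivAt g (4 * (α * stdNormalCDF (-α) - stdNormalPDF α)) α) ∧
      (∀ α, 4 * (α * stdNormalCDF (-α) - stdNormalPDF α) < 0) ∧
      Tendsto g atTop (nhds 0) := by
  have hneg : ∀ α, 4 * (α * stdNormalCDF (-α) - stdNormalPDF α) < 0 := fun α => by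
    linarith [mul_stdNormalCDF_neg_lt α]
  have hderiv : ∀ α, HasDerivAt g (4 * (α * stdNormalCDF (-α) - stdNormalPDF α)) α := fun α => by
    have hcdf : HasDerivAt (fun α => stdNormalCDF (-α)) (-stdNormalPDF α) α := by
      have h := (hasDerivAt_stdNormalCDF (-α)).comp α (hasDerivAt_neg α)
      rw [stdNormalPDF_neg, mul_neg_one] at h
      exact h
    have hsq : HasDerivAt (fun α : ℝ => 2 * (1 + α ^ 2)) (2 * (2 * α)) α := by
      simpa using (((hasDerivAt_id α).pow 2).const_add 1).const_mul 2
    have hlin : HasDerivAt (fun α : ℝ => 2 * α) 2 α := by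
      simpa using (hasDerivAt_id α).const_mul 2
    rw [funext hg]
    exact ((hsq.mul hcdf).sub (hlin.mul (hasDerivAt_stdNormalPDF α))).congr_deriv (by ring)
  refine ⟨?_, ?_, hderiv, hneg, ?_⟩
  · rw [hg, neg_zero, stdNormalCDF_zero]
    norm_num
  · exact strictAnti_of_deriv_neg fun α => (hderiv α).deriv.trans_lt (hneg α)
  · have hlo := tendsto_mul_stdNormalPDF_atTop.const_mul (-2)
    have hhi := tendsto_stdNormalPDF_atTop.const_mul 2
    rw [mul_zero] at hlo hhi
    refine tendsto_of_tendsto_of_tendsto_of_le_of_le' hlo hhi ?_ ?_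
    · refine Eventually.of_forall fun α => ?_
      have := mul_nonneg (by positivity : 0 ≤ 2 * (1 + α ^ 2)) (stdNormalCDF_nonneg (-α))
      simp only [hg]
      linarith
    · filter_upwards [eventually_ge_atTop 1] with α hα
      have hmills := mul_stdNormalCDF_neg_lt α
      have h1 := mul_le_mul_of_nonneg_left hmills.le (zero_le_one.trans hα)
      have h2 := le_mul_of_one_le_left (stdNormalCDF_nonneg (-α)) hα
      rw [hg]
      nlinarith
end
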